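/- Let X and Y be real vector spaces equipped with a bilinear form ⟨·,·⟩, let W be a set and θ : W → X a map, and let c_θ be the one-sided linear coupling c_θ(w,y) = ⟨θ(w), y⟩. Then for any function h : W → ℝ̄, the c_θ-Fenchel–Moreau biconjugate of h equals the Fenchel biconjugate of the infimal postcomposition θ ⋉ h composed with θ: for every w ∈ W, h^{c_θ c_θ'}(w) = (θ ⋉ h)⋆⋆(θ(w)). -/

import Mathlib

noncomputable section

/-- Infimal postcomposition `(θ ⋉ h)(x) = inf { h w : θ w = x }`, with `inf ∅ = +∞`. -/
def infPost {W X : Type*} (θ : W → X) (h : W → EReal) (x : X) : EReal :=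
  ⨅ (w : W) (_ : θ w = x), h w

variable {X Y W : Type*} [AddCommGroup X] [Module ℝ X] [AddCommGroup Y] [Module ℝ Y]

/-- Fenchel conjugate of a function on `X`, with respect to the bilinear form `B`. -/
def fenchelConjX (B : X →ₗ[ℝ] Y →ₗ[ℝ] ℝ) (g : X → EReal) (y : Y) : EReal :=
  ⨆ x : X, ((B x y : ℝ) : EReal) + (-g x)

/-- Fenchel biconjugate of a function on `X`, with respect to the bilinear form `B`. -/
def fenchelBiconjX (B : X →ₗ[ℝ] Y →ₗ[ℝ] ℝ) (g : X → EReal) (x : X) : EReal :=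
  ⨆ y : Y, ((B x y : ℝ) : EReal) + (-(fenchelConjX B g y))

/-- The `c_θ`-Fenchel–Moreau conjugate of `h : W → ℝ̄`, for the one-sided linear coupling
`c_θ(w,y) = ⟨θ(w), y⟩`. -/
def cThetaConj (B : X →ₗ[ℝ] Y →ₗ[ℝ] ℝ) (θ : W → X) (h : W → EReal) (y : Y) : EReal :=
  ⨆ w : W, ((B (θ w) y : ℝ) : EReal) + (-h w)

/-- The `c_θ`-Fenchel–Moreau biconjugate `h^{c_θ c_θ'}` of `h : W → ℝ̄`. -/
def cThetaBiconj (B : X →ₗ[ℝ] Y →ₗ[ℝ] ℝ) (θ : W → X) (h : W → EReal) (w : W) : EReal :=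
  ⨆ y : Y, ((B (θ w) y : ℝ) : EReal) + (-(cThetaConj B θ h y))

theorem fenchelConjX_infPost_eq (B : X →ₗ[ℝ] Y →ₗ[ℝ] ℝ) (θ : W → X) (h : W → EReal) (y : Y) :
    fenchelConjX B (infPost θ h) y = cThetaConj B θ h y := by
  have key : ∀ (a : ℝ) (u S : EReal), (a : EReal) + -u ≤ S ↔ -(S - (a : EReal)) ≤ u := by
    intro a u S
    rw [EReal.neg_le, EReal.le_sub_iff_add_le (Or.inl (EReal.coe_ne_bot a))
      (Or.inl (EReal.coe_ne_top a)), add_comm]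
  apply le_antisymm
  · refine iSup_le fun x => ?_
    rw [key]
    refine le_iInf fun w => le_iInf fun hw => ?_
    rw [← key, ← hw]
    exact le_iSup (fun w : W => ((B (θ w) y : ℝ) : EReal) + (-h w)) w
  · refine iSup_le fun w => ?_
    refine le_trans ?_ (le_iSup (fun x : X => ((B x y : ℝ) : EReal) + (-infPost θ h x)) (θ w))
    exact add_le_add le_rfl (EReal.neg_le_neg_iff.mpr (iInf₂_le (f := fun (v : W) (_ : θ v = θ w) => h v) w rfl))

/-- for the one-sided linear coupling `c_θ(w,y) = ⟨θ(w), y⟩`, the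
`c_θ`-Fenchel–Moreau biconjugate of `h : W → ℝ̄` equals the Fenchel biconjugate of the
infimal postcomposition `θ ⋉ h`, composed with `θ`. -/
theorem biconjugate_one_sided_linear_eq_fenchel_biconj_infPost
    (B : X →ₗ[ℝ] Y →ₗ[ℝ] ℝ) (θ : W → X) (h : W → EReal) (w : W) :
    cThetaBiconj B θ h w = fenchelBiconjX B (infPost θ h) (θ w) := by
  simp only [cThetaBiconj, fenchelBiconjX, fenchelConjX_infPost_eq]
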